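/- Under the standing assumptions on a and q, there exists N ∈ ℕ (depending only on a and q) such that for every bounded set K ⊂ [0,∞), every δ ∈ (0, 1/4) and every Λ > 0 there are constants C > 0 and b₀ > 0 with the following property: for all c ∈ K, all real b ≥ b₀ (set λ = −c + i·b), every C^∞ function φ : ℝ → ℝ with 0 ≤ φ ≤ 1 and sup_{x∈ℝ} |φ^{(j)}(x)| ≤ Λ·(δb)^{−j} for every j = 1, …, N, and every Schwartz function u : ℝ → ℂ, the commutator satisfies ‖𝓕((q + 2λa)·𝓕^{-1}(φ·u)) − φ·𝓕((q + 2λa)·𝓕^{-1}u)‖ ≤ C·(b^{-1}·‖T(λ)(𝓕^{-1}u)‖ + ‖u‖). -/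

import Mathlib

open MeasureTheory Filter
open scoped ENNReal

/-- The quadratic operator family `T(λ)u = -u'' + q·u + 2λ·a·u + λ²·u`. -/
noncomputable def Tq (a q : ℝ → ℝ) (lam : ℂ) (u : ℝ → ℂ) : ℝ → ℂ :=
  fun x => -deriv (deriv u) x + (q x : ℂ) * u x + 2 * lam * (a x : ℂ) * u x + lam ^ 2 * u x

/-- Standing assumptions on the damping `a` and the potential `q`. -/
structure Standing (a q : ℝ → ℝ) : Prop where
  smooth_a : ContDiff ℝ (⊤ : ℕ∞) a
  smooth_q : ContDiff ℝ (⊤ : ℕ∞) q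
  nonneg_a : ∀ x, 0 ≤ a x
  nonneg_q : ∀ x, 0 ≤ q x
  unbounded_a : Tendsto a (cocompact ℝ) atTop
  deriv_a : ∀ n : ℕ, 1 ≤ n → ∃ C : ℝ, 0 < C ∧ ∀ x : ℝ,
      |iteratedDeriv n a x| ≤ C * (1 + a x) * (1 + x ^ 2) ^ (-(n : ℝ) / 2)
  deriv_q : ∀ n : ℕ, 1 ≤ n → ∃ C : ℝ, 0 < C ∧ ∀ x : ℝ,
      |iteratedDeriv n q x| ≤ C * (1 + q x) * (1 + x ^ 2) ^ (-(n : ℝ) / 2)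
  q_le_a : ∃ K₀ : ℝ, 0 < K₀ ∧ ∃ x₀ : ℝ, 0 < x₀ ∧ ∀ x : ℝ, x₀ < |x| → q x ≤ K₀ * a x

/-- Fourier transform `𝓕u(ξ) = (2π)^(-1/2) ∫ e^(-iξx) u(x) dx`. -/
noncomputable def FT (u : ℝ → ℂ) : ℝ → ℂ :=
  fun ξ => (↑(Real.sqrt (2 * Real.pi)))⁻¹ * ∫ x : ℝ, Complex.exp (-(Complex.I * (ξ : ℂ) * (x : ℂ))) * u x

/-- Inverse Fourier transform `𝓕⁻¹u(x) = (2π)^(-1/2) ∫ e^(ixξ) u(ξ) dξ`. -/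
noncomputable def FTinv (u : ℝ → ℂ) : ℝ → ℂ :=
  fun x => (↑(Real.sqrt (2 * Real.pi)))⁻¹ * ∫ ξ : ℝ, Complex.exp (Complex.I * (x : ℂ) * (ξ : ℂ)) * u ξ

section partA
open FourierTransform
open scoped SchwartzMap

lemma FT_eq (f : ℝ → ℂ) (ξ : ℝ) :
    FT f ξ = (↑(Real.sqrt (2 * Real.pi)) : ℂ)⁻¹ * 𝓕 f (ξ / (2 * Real.pi)) := by
  rw [FT, Real.fourier_real_eq_integral_exp_smul]
  congr 1
  apply integral_congr_ae
  refine Eventually.of_forall fun x => ?_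
  simp only [smul_eq_mul]
  congr 2
  have : (Real.pi : ℂ) ≠ 0 := by exact_mod_cast Real.pi_ne_zero
  push_cast
  field_simp

lemma FTinv_eq (f : ℝ → ℂ) (x : ℝ) : FTinv f x = FT f (-x) := by
  simp only [FT, FTinv]
  congr 1
  apply integral_congr_ae
  refine Eventually.of_forall fun x => ?_
  simp only [Complex.ofReal_neg]
  congr 2
  ring

lemma kappa_pos : 0 < (Real.sqrt (2 * Real.pi))⁻¹ := by positivity

lemma kappa_norm : ‖(↑(Real.sqrt (2 * Real.pi)) : ℂ)⁻¹‖ = (Real.sqrt (2 * Real.pi))⁻¹ := by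
  rw [norm_inv, Complex.norm_real, Real.norm_of_nonneg (by positivity)]

lemma kappa_le_one : (Real.sqrt (2 * Real.pi))⁻¹ ≤ 1 := by
  apply inv_le_one_of_one_le₀
  rw [Real.one_le_sqrt]
  nlinarith [Real.pi_gt_three]

lemma exists_FT (u : 𝓢(ℝ, ℂ)) : ∃ U : 𝓢(ℝ, ℂ), ⇑U = FT u := by
  have h0 : (2 * Real.pi)⁻¹ ≠ 0 := by positivity
  refine ⟨((↑(Real.sqrt (2 * Real.pi)) : ℂ)⁻¹) • SchwartzMap.compCLMOfContinuousLinearEquiv ℂ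
    (ContinuousLinearEquiv.unitsEquivAut ℝ (Units.mk0 _ h0)) (𝓕 u), ?_⟩
  ext ξ
  rw [FT_eq]
  simp [SchwartzMap.fourier_coe, div_eq_mul_inv]

lemma exists_FTinv (u : 𝓢(ℝ, ℂ)) : ∃ U : 𝓢(ℝ, ℂ), ⇑U = FTinv u := by
  obtain ⟨U, hU⟩ := exists_FT u
  refine ⟨SchwartzMap.compCLMOfContinuousLinearEquiv ℂ (ContinuousLinearEquiv.neg ℝ) U, ?_⟩
  ext x
  rw [FTinv_eq, ← hU]
  simp

lemma eLpNorm_schwartz (f : 𝓢(ℝ, ℂ)) :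
    eLpNorm f 2 volume = ENNReal.ofReal (Real.sqrt (∫ x, ‖f x‖ ^ 2)) := by
  rw [MemLp.eLpNorm_eq_integral_rpow_norm (by norm_num) (by norm_num) (f.memLp 2 volume)]
  simp only [ENNReal.toReal_ofNat, Real.rpow_ofNat]
  rw [Real.sqrt_eq_rpow]
  norm_num

lemma eLpNorm_FT (f : 𝓢(ℝ, ℂ)) : eLpNorm (FT f) 2 volume = eLpNorm f 2 volume := by
  obtain ⟨U, hU⟩ := exists_FT f
  rw [← hU, eLpNorm_schwartz, eLpNorm_schwartz]
  congr 2
  rw [hU, ← SchwartzMap.integral_norm_sq_fourier f]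
  have h1 : ∀ ξ, ‖FT f ξ‖ ^ 2 = (2 * Real.pi)⁻¹ * ‖(𝓕 f) (ξ / (2 * Real.pi))‖ ^ 2 := by
    intro ξ
    rw [FT_eq, norm_mul, kappa_norm, mul_pow, inv_pow, Real.sq_sqrt (by positivity),
      SchwartzMap.fourier_coe]
  simp_rw [h1]
  rw [integral_const_mul, Measure.integral_comp_div (fun y => ‖(𝓕 f : 𝓢(ℝ, ℂ)) y‖ ^ 2), smul_eq_mul,
    abs_of_pos (by positivity), ← mul_assoc, inv_mul_cancel₀ (by positivity), one_mul]

lemma eLpNorm_FTinv (f : 𝓢(ℝ, ℂ)) : eLpNorm (FTinv f) 2 volume = eLpNorm f 2 volume := by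
  rw [← eLpNorm_FT f]
  have : FTinv f = FT f ∘ (fun x => -x) := by ext x; simp [FTinv_eq]
  rw [this]
  obtain ⟨U, hU⟩ := exists_FT f
  rw [← hU]
  exact eLpNorm_comp_measurePreserving U.continuous.aestronglyMeasurable
    (Measure.measurePreserving_neg volume)

/-- Fubini. -/
lemma FT_mul_FTinv {P g : ℝ → ℂ} (hP : Integrable P) (hg : Integrable g) (ξ : ℝ) :
    FT (fun x => P x * FTinv g x) ξ
      = (↑(Real.sqrt (2 * Real.pi)) : ℂ)⁻¹ * ∫ η, FT P (ξ - η) * g η := by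
  have key : ∫ x : ℝ, ∫ η : ℝ, Complex.exp (-(Complex.I * (ξ : ℂ) * (x : ℂ))) * P x *
      (Complex.exp (Complex.I * (x : ℂ) * (η : ℂ)) * g η) =
      ∫ η : ℝ, ∫ x : ℝ, Complex.exp (-(Complex.I * (ξ : ℂ) * (x : ℂ))) * P x *
      (Complex.exp (Complex.I * (x : ℂ) * (η : ℂ)) * g η) := by
    apply integral_integral_swap
    have h1 : Integrable (fun z : ℝ × ℝ => P z.1 * g z.2) (volume.prod volume) := hP.mul_prod hg
    have h2 := h1.bdd_mul (c := 1) (f := fun z : ℝ × ℝ =>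
      Complex.exp (-(Complex.I * (ξ : ℂ) * (z.1 : ℂ))) *
        Complex.exp (Complex.I * (z.1 : ℂ) * (z.2 : ℂ))) (by
        apply Continuous.aestronglyMeasurable; fun_prop) (by
        refine Eventually.of_forall fun z => ?_
        rw [norm_mul, Complex.norm_exp, Complex.norm_exp]
        simp)
    refine h2.congr (Eventually.of_forall fun z => ?_)
    simp only [Function.uncurry]
    ring
  simp only [FT, FTinv]
  congr 1
  calc _ = (↑(Real.sqrt (2 * Real.pi)) : ℂ)⁻¹ * ∫ x : ℝ, ∫ η : ℝ,
      Complex.exp (-(Complex.I * (ξ : ℂ) * (x : ℂ))) * P x *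
      (Complex.exp (Complex.I * (x : ℂ) * (η : ℂ)) * g η) := by
        rw [← integral_const_mul]
        congr 1; ext x
        rw [integral_const_mul]
        ring
    _ = _ := by
        rw [key, ← integral_const_mul]
        congr 1; ext η
        rw [mul_assoc, ← integral_mul_const]
        congr 2; ext x
        rw [show -(Complex.I * ((ξ - η : ℝ) : ℂ) * (x : ℂ)) =
          -(Complex.I * (ξ : ℂ) * (x : ℂ)) + Complex.I * (x : ℂ) * (η : ℂ) by push_cast; ring,
          Complex.exp_add]
        ring

lemma norm_FT_le (f : ℝ → ℂ) (ξ : ℝ) : ‖FT f ξ‖ ≤ ∫ x, ‖f x‖ := by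
  rw [FT, norm_mul, kappa_norm]
  have h1 : ‖∫ x : ℝ, Complex.exp (-(Complex.I * (ξ : ℂ) * (x : ℂ))) * f x‖ ≤ ∫ x, ‖f x‖ := by
    refine (norm_integral_le_integral_norm _).trans (le_of_eq ?_)
    congr 1; ext x
    rw [norm_mul, Complex.norm_exp]
    simp
  have h2 : 0 ≤ ∫ x, ‖f x‖ := integral_nonneg fun x => norm_nonneg _
  calc _ ≤ 1 * ∫ x, ‖f x‖ := mul_le_mul kappa_le_one h1 (norm_nonneg _) zero_le_one
    _ = _ := one_mul _

lemma FT_iteratedDeriv {f : ℝ → ℂ} {N n : ℕ} (hf : ContDiff ℝ N f)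
    (hi : ∀ k ≤ N, Integrable (iteratedDeriv k f)) (hn : n ≤ N) (ξ : ℝ) :
    FT (iteratedDeriv n f) ξ = (Complex.I * ξ) ^ n * FT f ξ := by
  rw [FT_eq, FT_eq, Real.fourier_iteratedDeriv (N := (N : ℕ∞)) (by exact_mod_cast hf)
    (fun k hk => hi k (by exact_mod_cast hk)) (by exact_mod_cast hn)]
  simp only [smul_eq_mul]
  have : (Real.pi : ℂ) ≠ 0 := by exact_mod_cast Real.pi_ne_zero
  have h3 : (2 * (Real.pi : ℂ) * Complex.I * ((ξ / (2 * Real.pi) : ℝ) : ℂ)) = Complex.I * ξ := by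
    push_cast; field_simp
  rw [h3]; ring
end partA

section partB
open FourierTransform
open scoped SchwartzMap

lemma cs_ennreal {k f : ℝ → ℝ≥0∞} (hk : Measurable k) (hf : Measurable f) :
    (∫⁻ x, k x * f x) ^ 2 ≤ (∫⁻ x, k x) * ∫⁻ x, k x * f x ^ 2 := by
  have h := ENNReal.lintegral_mul_le_Lp_mul_Lq volume Real.HolderConjugate.two_two
    (f := fun x => k x ^ (1 / 2 : ℝ)) (g := fun x => k x ^ (1 / 2 : ℝ) * f x)
    (by fun_prop) (by fun_prop)
  have e1 : ∀ x, k x ^ (1 / 2 : ℝ) * k x ^ (1 / 2 : ℝ) = k x := fun x => by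
    rw [← ENNReal.rpow_add_of_nonneg _ _ (by norm_num) (by norm_num)]; norm_num
  have e2 : ∀ x, (k x ^ (1 / 2 : ℝ)) ^ (2 : ℝ) = k x := fun x => by
    rw [← ENNReal.rpow_mul]; norm_num
  have e3 : ∀ x, (k x ^ (1 / 2 : ℝ) * f x) ^ (2 : ℝ) = k x * f x ^ 2 := fun x => by
    rw [ENNReal.mul_rpow_of_nonneg _ _ (by norm_num), e2]; norm_num
  simp only [Pi.mul_apply, ← mul_assoc, e1, e2, e3] at h
  calc _ ≤ ((∫⁻ x, k x) ^ (1 / 2 : ℝ) * (∫⁻ x, k x * f x ^ 2) ^ (1 / 2 : ℝ)) ^ 2 := by gcongr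
    _ = _ := by
      rw [mul_pow, ← ENNReal.rpow_natCast, ← ENNReal.rpow_mul, ← ENNReal.rpow_natCast,
        ← ENNReal.rpow_mul]
      norm_num

lemma young_ennreal {k f : ℝ → ℝ≥0∞} (hk : Measurable k) (hf : Measurable f) :
    ∫⁻ ξ, (∫⁻ η, k (ξ - η) * f η) ^ 2 ≤ (∫⁻ x, k x) ^ 2 * ∫⁻ x, f x ^ 2 := by
  have h1 : ∀ ξ, (∫⁻ η, k (ξ - η) * f η) ^ 2 ≤ (∫⁻ x, k x) * ∫⁻ η, k (ξ - η) * f η ^ 2 := by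
    intro ξ
    have := cs_ennreal (k := fun η => k (ξ - η)) (f := f) (by fun_prop) hf
    rwa [lintegral_sub_left_eq_self (fun x => k x) ξ] at this
  calc _ ≤ ∫⁻ ξ, (∫⁻ x, k x) * ∫⁻ η, k (ξ - η) * f η ^ 2 := lintegral_mono h1
    _ = (∫⁻ x, k x) * ∫⁻ ξ, ∫⁻ η, k (ξ - η) * f η ^ 2 := by
      rw [lintegral_const_mul]
      apply Measurable.lintegral_prod_right
      fun_prop
    _ = (∫⁻ x, k x) * ∫⁻ η, ∫⁻ ξ, k (ξ - η) * f η ^ 2 := by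
      rw [lintegral_lintegral_swap]
      apply Measurable.aemeasurable
      simp only [Function.uncurry_def]
      fun_prop
    _ = (∫⁻ x, k x) * ∫⁻ η, (∫⁻ x, k x) * f η ^ 2 := by
      congr 2; ext η
      rw [lintegral_mul_const _ (by fun_prop), lintegral_sub_right_eq_self (fun x => k x) η]
    _ = _ := by
      rw [lintegral_const_mul _ (by fun_prop)]; ring

lemma young_cauchy {F : ℝ → ℂ} {G : ℝ → ℝ → ℂ} (u : 𝓢(ℝ, ℂ)) {M : ℝ} (hM : 0 ≤ M)
    (hF : ∀ ξ, F ξ = ∫ η, G ξ η)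
    (hG : ∀ ξ η, ‖G ξ η‖ ≤ M * (1 + (ξ - η) ^ 2)⁻¹ * ‖u η‖) :
    eLpNorm F 2 volume ≤ ENNReal.ofReal (M * Real.pi) * eLpNorm u 2 volume := by
  set k : ℝ → ℝ≥0∞ := fun x => ENNReal.ofReal (M * (1 + x ^ 2)⁻¹) with hk
  have hkm : Measurable k := by fun_prop
  have hum : Measurable (fun x => ‖u x‖ₑ) := u.continuous.measurable.enorm
  have hkint : ∫⁻ x, k x = ENNReal.ofReal (M * Real.pi) := by
    rw [← ofReal_integral_eq_lintegral_ofReal (integrable_inv_one_add_sq.const_mul M)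
      (Eventually.of_forall fun x => by positivity), integral_const_mul,
      integral_univ_inv_one_add_sq]
  have hb : ∀ ξ, ‖F ξ‖ₑ ≤ ∫⁻ η, k (ξ - η) * ‖u η‖ₑ := by
    intro ξ
    rw [hF]
    refine (enorm_integral_le_lintegral_enorm _).trans (lintegral_mono fun η => ?_)
    rw [hk]
    simp only
    rw [← ofReal_norm, ← ofReal_norm, ← ENNReal.ofReal_mul (by positivity)]
    exact ENNReal.ofReal_le_ofReal (hG ξ η)
  rw [eLpNorm_eq_lintegral_rpow_enorm_toReal (by norm_num) (by norm_num),
    eLpNorm_eq_lintegral_rpow_enorm_toReal (by norm_num) (by norm_num)]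
  simp only [ENNReal.toReal_ofNat, ENNReal.rpow_ofNat]
  calc _ ≤ (∫⁻ ξ, (∫⁻ η, k (ξ - η) * ‖u η‖ₑ) ^ 2) ^ (1 / 2 : ℝ) := by
        gcongr with ξ; exact hb ξ
    _ ≤ (ENNReal.ofReal (M * Real.pi) ^ 2 * ∫⁻ x, ‖u x‖ₑ ^ 2) ^ (1 / 2 : ℝ) := by
        gcongr; rw [← hkint]; exact young_ennreal hkm hum
    _ = _ := by
        rw [ENNReal.mul_rpow_of_nonneg _ _ (by norm_num), ← ENNReal.rpow_natCast,
          ← ENNReal.rpow_mul]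
        norm_num

lemma taylor_bound {φ : ℝ → ℝ} (hφ : ContDiff ℝ (⊤ : ℕ∞) φ) {n : ℕ} {B : ℝ}
    (hB : ∀ x, |iteratedDeriv (n + 1) φ x| ≤ B) (ξ η : ℝ) :
    |φ η - ∑ k ∈ Finset.range (n + 1), ((k.factorial : ℝ)⁻¹ * (η - ξ) ^ k) * iteratedDeriv k φ ξ|
      ≤ B * |η - ξ| ^ (n + 1) := by
  have hB0 : 0 ≤ B := (abs_nonneg _).trans (hB 0)
  rcases eq_or_ne ξ η with rfl | hne
  · rw [Finset.sum_range_succ']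
    simp
  · obtain ⟨x', -, h⟩ := taylor_mean_remainder_lagrange_iteratedDeriv (n := n) hne
      (f := φ) ((hφ.of_le (by exact_mod_cast le_top)).contDiffOn)
    rw [taylor_within_apply] at h
    have h2 : ∀ k ∈ Finset.range (n + 1), ((k.factorial : ℝ)⁻¹ * (η - ξ) ^ k) •
        iteratedDerivWithin k φ (Set.uIcc ξ η) ξ =
        ((k.factorial : ℝ)⁻¹ * (η - ξ) ^ k) * iteratedDeriv k φ ξ := by
      intro k _
      rw [iteratedDerivWithin_eq_iteratedDeriv (uniqueDiffOn_uIcc hne)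
        ((hφ.of_le (by exact_mod_cast le_top)).contDiffAt) Set.left_mem_uIcc, smul_eq_mul]
    rw [Finset.sum_congr rfl h2] at h
    rw [h, abs_div, abs_mul, abs_pow]
    have hf : (1 : ℝ) ≤ |((n + 1).factorial : ℝ)| := by
      rw [abs_of_nonneg (by positivity)]
      exact_mod_cast Nat.one_le_iff_ne_zero.mpr (Nat.factorial_ne_zero _)
    calc _ ≤ |iteratedDeriv (n + 1) φ x'| * |η - ξ| ^ (n + 1) := div_le_self (by positivity) hf
      _ ≤ _ := by gcongr; exact hB x'

lemma FT_continuous {f : ℝ → ℂ} (hf : Integrable f) : Continuous (FT f) := by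
  unfold FT
  refine continuous_const.mul ?_
  refine continuous_of_dominated (bound := fun x => ‖f x‖) (fun ξ => ?_) (fun ξ => ?_) hf.norm ?_
  · exact (Continuous.aestronglyMeasurable (by fun_prop)).mul hf.1
  · refine Eventually.of_forall fun x => ?_
    rw [norm_mul, Complex.norm_exp]
    simp
  · exact Eventually.of_forall fun x => by fun_prop

lemma FTinv_continuous {f : ℝ → ℂ} (hf : Integrable f) : Continuous (FTinv f) := by
  have : FTinv f = fun x => FT f (-x) := by ext x; exact FTinv_eq f x
  rw [this]
  have := FT_continuous hf
  fun_prop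

lemma norm_FTinv_le (f : ℝ → ℂ) (ξ : ℝ) : ‖FTinv f ξ‖ ≤ ∫ x, ‖f x‖ := by
  rw [FTinv_eq]; exact norm_FT_le f _

lemma mul_FTinv_integrable {P f : ℝ → ℂ} (hP : Integrable P) (hf : Integrable f) :
    Integrable (fun x => P x * FTinv f x) :=
  hP.mul_bdd (c := ∫ x, ‖f x‖) (FTinv_continuous hf).aestronglyMeasurable
    (Eventually.of_forall fun x => norm_FTinv_le f x)
end partB

section partC
open FourierTransform
open scoped SchwartzMap

/-- The commutator on the Fourier side. -/
noncomputable def commF (P : ℝ → ℂ) (φ : ℝ → ℝ) (u : ℝ → ℂ) : ℝ → ℂ := fun ξ =>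
  FT (fun x => P x * FTinv (fun y => (φ y : ℂ) * u y) x) ξ
    - (φ ξ : ℂ) * FT (fun x => P x * FTinv u x) ξ

lemma contDiff_iteratedDeriv' {P : ℝ → ℂ} (hP : ContDiff ℝ (⊤ : ℕ∞) P) (k : ℕ) :
    ContDiff ℝ (⊤ : ℕ∞) (iteratedDeriv k P) := by
  rw [contDiff_infty] at *
  intro n
  exact (hP (n + k)).iterate_deriv' n k |> fun h => by rwa [iteratedDeriv_eq_iterate]

lemma compact_iteratedDeriv {P : ℝ → ℂ} (hPc : HasCompactSupport P) (k : ℕ) :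
    HasCompactSupport (iteratedDeriv k P) := by
  induction k with
  | zero => simpa using hPc
  | succ k ih => rw [iteratedDeriv_succ]; exact ih.deriv

lemma integrable_iteratedDeriv {P : ℝ → ℂ} (hP : ContDiff ℝ (⊤ : ℕ∞) P)
    (hPc : HasCompactSupport P) (k : ℕ) : Integrable (iteratedDeriv k P) :=
  (contDiff_iteratedDeriv' hP k).continuous.integrable_of_hasCompactSupport
    (compact_iteratedDeriv hPc k)

lemma phi_mul_integrable {φ : ℝ → ℝ} (hφ : ContDiff ℝ (⊤ : ℕ∞) φ)
    (h01 : ∀ x, 0 ≤ φ x ∧ φ x ≤ 1) (u : 𝓢(ℝ, ℂ)) :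
    Integrable (fun y => (φ y : ℂ) * u y) := by
  refine u.integrable.bdd_mul (c := 1) ?_ (Eventually.of_forall fun x => ?_)
  · have := hφ.continuous
    exact Continuous.aestronglyMeasurable (by fun_prop)
  · rw [Complex.norm_real, Real.norm_of_nonneg (h01 x).1]; exact (h01 x).2

lemma commF_measurable {P : ℝ → ℂ} (hP : Integrable P)
    {φ : ℝ → ℝ} (hφ : ContDiff ℝ (⊤ : ℕ∞) φ)
    (h01 : ∀ x, 0 ≤ φ x ∧ φ x ≤ 1) (u : 𝓢(ℝ, ℂ)) : Continuous (commF P φ u) := by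
  have h1 := FT_continuous (mul_FTinv_integrable hP (phi_mul_integrable hφ h01 u))
  have h2 := FT_continuous (mul_FTinv_integrable hP u.integrable)
  have := hφ.continuous
  unfold commF
  fun_prop

lemma comm_compact {P : ℝ → ℂ} (hP : ContDiff ℝ (⊤ : ℕ∞) P) (hPc : HasCompactSupport P)
    {n : ℕ} {φ : ℝ → ℝ} (hφ : ContDiff ℝ (⊤ : ℕ∞) φ) (h01 : ∀ x, 0 ≤ φ x ∧ φ x ≤ 1)
    {s L : ℝ} (hs : 1 ≤ s) (hL : 0 ≤ L)
    (hd : ∀ j : ℕ, 1 ≤ j → j ≤ n + 1 → ∀ x : ℝ, |iteratedDeriv j φ x| ≤ L / s ^ j)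
    (u : 𝓢(ℝ, ℂ)) {W : ℝ≥0∞} {B : ℝ}
    (hW : ∀ j : ℕ, 1 ≤ j → j ≤ n →
      eLpNorm (fun x => iteratedDeriv j P x * FTinv u x) 2 volume ≤ W)
    (hB : (∫ x, ‖iteratedDeriv (n + 1) P x‖) + (∫ x, ‖iteratedDeriv (n + 3) P x‖) ≤ B) :
    eLpNorm (commF P φ u) 2 volume ≤
      ENNReal.ofReal (L / s) * (n * W + ENNReal.ofReal (B * Real.pi) * eLpNorm u 2 volume) := by
  set κ : ℂ := (↑(Real.sqrt (2 * Real.pi)) : ℂ)⁻¹ with hκ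
  have hPi := integrable_iteratedDeriv hP hPc
  have hPi0 : Integrable P := by simpa using hPi 0
  have hFTd : ∀ (k : ℕ) (ζ : ℝ), FT (iteratedDeriv k P) ζ = (Complex.I * ζ) ^ k * FT P ζ :=
    fun k ζ => FT_iteratedDeriv (N := k) (hP.of_le (by exact_mod_cast le_top))
      (fun j _ => hPi j) le_rfl ζ
  have hB0 : 0 ≤ B := le_trans (add_nonneg (integral_nonneg fun _ => norm_nonneg _)
    (integral_nonneg fun _ => norm_nonneg _)) hB
  have hsj : ∀ j : ℕ, 1 ≤ j → L / s ^ j ≤ L / s := by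
    intro j hj
    apply div_le_div_of_nonneg_left hL (by linarith)
    calc s = s ^ 1 := (pow_one s).symm
      _ ≤ s ^ j := pow_le_pow_right₀ hs hj
  -- Taylor terms
  set T : ℕ → ℝ → ℂ := fun k ξ => ((k.factorial : ℂ)⁻¹ * Complex.I ^ k * ((iteratedDeriv k φ ξ : ℝ) : ℂ))
    * FT (fun x => iteratedDeriv k P x * FTinv u x) ξ with hT
  set A : ℝ → ℕ → ℝ → ℂ := fun ξ k η =>
    ((k.factorial : ℂ)⁻¹ * Complex.I ^ k * ((iteratedDeriv k φ ξ : ℝ) : ℂ) * κ)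
      * (FT (iteratedDeriv k P) (ξ - η) * u η) with hA
  set G : ℝ → ℝ → ℂ := fun ξ η => κ * (FT P (ξ - η) * ((φ η : ℂ) * u η))
    - ∑ k ∈ Finset.range (n + 1), A ξ k η with hG
  have hφu := phi_mul_integrable hφ h01 u
  have hbd : ∀ {Q g : ℝ → ℂ}, Integrable Q → Integrable g → ∀ ξ,
      Integrable (fun η => FT Q (ξ - η) * g η) := by
    intro Q g hQ hg ξ
    have := FT_continuous hQ
    exact hg.bdd_mul (c := ∫ x, ‖Q x‖) (Continuous.aestronglyMeasurable (by fun_prop))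
      (Eventually.of_forall fun x => norm_FT_le Q _)
  have hAi : ∀ ξ k, Integrable (A ξ k) := fun ξ k =>
    (hbd (hPi k) u.integrable ξ).const_mul _
  have hTA : ∀ ξ k, ∫ η, A ξ k η = T k ξ := by
    intro ξ k
    simp only [hA, hT]
    rw [integral_const_mul, FT_mul_FTinv (hPi k) u.integrable]
    ring
  have hdecomp : ∀ ξ, commF P φ u ξ = (∑ k ∈ Finset.range n, T (k + 1) ξ) + ∫ η, G ξ η := by
    intro ξ
    have h1 : ∫ η, G ξ η = FT (fun x => P x * FTinv (fun y => (φ y : ℂ) * u y) x) ξ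
        - ∑ k ∈ Finset.range (n + 1), T k ξ := by
      simp only [hG]
      rw [integral_sub ((hbd hPi0 hφu ξ).const_mul κ) (integrable_finsetSum _ fun k _ => hAi ξ k),
        integral_finsetSum _ (fun k _ => hAi ξ k), integral_const_mul,
        FT_mul_FTinv hPi0 hφu]
      simp_rw [hTA]
      rfl
    rw [h1, Finset.sum_range_succ', commF]
    simp only [hT, Nat.factorial_zero, iteratedDeriv_zero]
    simp
    ring
  have hGb : ∀ ξ η, ‖G ξ η‖ ≤ (L / s * B) * (1 + (ξ - η) ^ 2)⁻¹ * ‖u η‖ := by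
    intro ξ η
    have e1 : G ξ η = κ * FT P (ξ - η) * u η * ((φ η - ∑ k ∈ Finset.range (n + 1),
        ((k.factorial : ℝ)⁻¹ * (η - ξ) ^ k) * iteratedDeriv k φ ξ : ℝ) : ℂ) := by
      simp only [hG, hA]
      push_cast
      rw [mul_sub, Finset.mul_sum]
      congr 1
      · ring
      · refine Finset.sum_congr rfl fun k _ => ?_
        rw [hFTd]
        have : Complex.I ^ k * (Complex.I * ((ξ - η : ℝ) : ℂ)) ^ k = ((η : ℂ) - ξ) ^ k := by
          rw [← mul_pow, ← mul_assoc, Complex.I_mul_I]; push_cast; ring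
        rw [← this]; ring
    have e2 := taylor_bound hφ (hd (n + 1) (by omega) le_rfl) ξ η
    have e3 : (1 + (ξ - η) ^ 2) * (|η - ξ| ^ (n + 1) * ‖FT P (ξ - η)‖) ≤ B := by
      refine le_trans (le_of_eq ?_) ((add_le_add (norm_FT_le (iteratedDeriv (n + 1) P) (ξ - η))
        (norm_FT_le (iteratedDeriv (n + 3) P) (ξ - η))).trans hB)
      rw [hFTd, hFTd, norm_mul, norm_mul, norm_pow, norm_pow, norm_mul, Complex.norm_I,
        Complex.norm_real, Real.norm_eq_abs, one_mul, abs_sub_comm η ξ, ← sq_abs (ξ - η)]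
      ring
    have e4 : |η - ξ| ^ (n + 1) * ‖FT P (ξ - η)‖ ≤ B * (1 + (ξ - η) ^ 2)⁻¹ := by
      rw [← div_eq_mul_inv, le_div_iff₀ (by positivity)]; linarith
    rw [e1, norm_mul, norm_mul, norm_mul, Complex.norm_real, Real.norm_eq_abs]
    have hκ1 : ‖κ‖ ≤ 1 := by rw [hκ, kappa_norm]; exact kappa_le_one
    calc _ ≤ 1 * ‖FT P (ξ - η)‖ * ‖u η‖ * (L / s ^ (n + 1) * |η - ξ| ^ (n + 1)) := by gcongr
      _ = L / s ^ (n + 1) * (|η - ξ| ^ (n + 1) * ‖FT P (ξ - η)‖) * ‖u η‖ := by ring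
      _ ≤ L / s * (B * (1 + (ξ - η) ^ 2)⁻¹) * ‖u η‖ := by
        gcongr; exact le_self_pow₀ hs (by omega)
      _ = _ := by ring
  -- Schwartz pieces
  have hsch : ∀ k, ∃ S : 𝓢(ℝ, ℂ), ⇑S = fun x => iteratedDeriv k P x * FTinv u x := by
    intro k
    obtain ⟨U, hU⟩ := exists_FTinv u
    refine ⟨HasCompactSupport.toSchwartzMap (f := fun x => iteratedDeriv k P x * FTinv u x)
      (compact_iteratedDeriv hPc k).mul_right ?_, rfl⟩
    rw [← hU]
    exact (contDiff_iteratedDeriv' hP k).mul (U.smooth ⊤)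
  have hTm : ∀ k, Continuous (T k) := by
    intro k
    have h1 := FT_continuous (mul_FTinv_integrable (hPi k) u.integrable)
    have h2 : Continuous (iteratedDeriv k φ) :=
      hφ.continuous_iteratedDeriv k (by exact_mod_cast le_top)
    simp only [hT]
    fun_prop
  have hTb : ∀ k ∈ Finset.range n, eLpNorm (T (k + 1)) 2 volume ≤ ENNReal.ofReal (L / s) * W := by
    intro k hk
    rw [Finset.mem_range] at hk
    obtain ⟨S, hS⟩ := hsch (k + 1)
    have h1 : eLpNorm (T (k + 1)) 2 volume ≤ ENNReal.ofReal (L / s) *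
        eLpNorm (FT S) 2 volume := by
      apply eLpNorm_le_mul_eLpNorm_of_ae_le_mul
      refine Eventually.of_forall fun ξ => ?_
      simp only [hT]
      rw [norm_mul, hS]
      gcongr
      rw [norm_mul, norm_mul, norm_pow, Complex.norm_I, one_pow, mul_one, Complex.norm_real,
        Real.norm_eq_abs, norm_inv]
      have hf : ‖(((k + 1).factorial : ℕ) : ℂ)‖⁻¹ ≤ 1 := by
        apply inv_le_one_of_one_le₀
        rw [Complex.norm_natCast]
        exact_mod_cast Nat.one_le_iff_ne_zero.mpr (Nat.factorial_ne_zero _)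
      calc _ ≤ 1 * (L / s ^ (k + 1)) := by
            gcongr; exact hd _ (by omega) (by omega) ξ
        _ ≤ L / s := by rw [one_mul]; exact hsj _ (by omega)
    rw [eLpNorm_FT, hS] at h1
    exact h1.trans (by gcongr; exact hW _ (by omega) (by omega))
  have hfun : commF P φ u = (∑ k ∈ Finset.range n, T (k + 1)) + fun ξ => ∫ η, G ξ η := by
    ext ξ; rw [hdecomp]; simp
  have hsumc : Continuous (∑ k ∈ Finset.range n, T (k + 1)) := by
    have : (∑ k ∈ Finset.range n, T (k + 1)) = fun ξ => ∑ k ∈ Finset.range n, T (k + 1) ξ := by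
      ext ξ; simp
    rw [this]
    exact continuous_finsetSum _ fun k _ => hTm (k + 1)
  have hRm : Continuous (fun ξ => ∫ η, G ξ η) := by
    have : (fun ξ => ∫ η, G ξ η) = commF P φ u - ∑ k ∈ Finset.range n, T (k + 1) := by
      rw [hfun]; ext ξ; simp
    rw [this]
    exact (commF_measurable hPi0 hφ h01 u).sub hsumc
  have hR : eLpNorm (fun ξ => ∫ η, G ξ η) 2 volume ≤
      ENNReal.ofReal (L / s * B * Real.pi) * eLpNorm u 2 volume :=
    young_cauchy u (by positivity) (fun ξ => rfl) hGb
  rw [hfun]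
  refine (eLpNorm_add_le hsumc.aestronglyMeasurable hRm.aestronglyMeasurable (by norm_num)).trans ?_
  rw [mul_add]
  refine add_le_add ?_ ?_
  · refine (eLpNorm_sum_le (fun k _ => (hTm (k + 1)).aestronglyMeasurable) (by norm_num)).trans ?_
    refine (Finset.sum_le_sum hTb).trans (le_of_eq ?_)
    rw [Finset.sum_const, Finset.card_range, nsmul_eq_mul]
    ring
  · refine hR.trans (le_of_eq ?_)
    rw [← mul_assoc, ← ENNReal.ofReal_mul (by positivity), ← mul_assoc]
end partC

section partD
open FourierTransform
open scoped SchwartzMap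

/-- The weight `(1+x²)^{-1/2}`. -/
noncomputable def rr (x : ℝ) : ℝ := (Real.sqrt (1 + x ^ 2))⁻¹

lemma rr_pos (x : ℝ) : 0 < rr x := by unfold rr; positivity
lemma rr_le_one (x : ℝ) : rr x ≤ 1 := by
  unfold rr
  apply inv_le_one_of_one_le₀
  rw [Real.one_le_sqrt]; nlinarith [sq_nonneg x]
lemma rr_sq (x : ℝ) : rr x ^ 2 = (1 + x ^ 2)⁻¹ := by
  unfold rr
  rw [inv_pow, Real.sq_sqrt (by positivity)]
lemma rr_continuous : Continuous rr := by
  unfold rr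
  refine Continuous.inv₀ (by fun_prop) (fun x => by positivity)
lemma rr_scale {e : ℝ} (he : 0 < e) (he1 : e ≤ 1) (x : ℝ) : e * rr (e * x) ≤ rr x := by
  unfold rr
  rw [← div_eq_mul_inv, div_le_iff₀ (by positivity), inv_mul_eq_div, le_div_iff₀ (by positivity)]
  rw [← Real.sqrt_sq he.le, ← Real.sqrt_mul (by positivity), Real.sqrt_sq he.le]
  apply Real.sqrt_le_sqrt
  nlinarith

lemma norm_iteratedDeriv_ofReal {f : ℝ → ℝ} (hf : ContDiff ℝ (⊤ : ℕ∞) f) (k : ℕ) (x : ℝ) :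
    ‖iteratedDeriv k (fun y => (f y : ℂ)) x‖ = |iteratedDeriv k f x| := by
  have h := Complex.ofRealLI.norm_iteratedFDeriv_comp_left (n := (k : ℕ)) (f := f) (x := x) (i := k)
    (hf.of_le (by exact_mod_cast le_top)).contDiffAt le_rfl
  rw [norm_iteratedFDeriv_eq_norm_iteratedDeriv, norm_iteratedFDeriv_eq_norm_iteratedDeriv,
    Real.norm_eq_abs] at h
  exact h

lemma contDiff_ofReal' {f : ℝ → ℝ} (hf : ContDiff ℝ (⊤ : ℕ∞) f) :
    ContDiff ℝ (⊤ : ℕ∞) (fun y => (f y : ℂ)) := Complex.ofRealCLM.contDiff.comp hf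

lemma FTinv_decay {φ : ℝ → ℝ} (hφ : ContDiff ℝ (⊤ : ℕ∞) φ) {N : ℕ}
    (hd : ∀ j ≤ N, ∃ C : ℝ, ∀ x, |iteratedDeriv j φ x| ≤ C) (u : 𝓢(ℝ, ℂ)) :
    ∃ C : ℝ, 0 ≤ C ∧ ∀ x, ‖FTinv (fun y => (φ y : ℂ) * u y) x‖ ≤ C * rr x ^ N := by
  set g : ℝ → ℂ := fun y => (φ y : ℂ) * u y with hg
  have hφc := contDiff_ofReal' hφ
  have hu : ContDiff ℝ (⊤ : ℕ∞) u := u.smooth ⊤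
  have hgs : ContDiff ℝ (⊤ : ℕ∞) g := hφc.mul hu
  have hui : ∀ j, Integrable (iteratedDeriv j u) := by
    intro j
    have h := u.integrable_pow_mul_iteratedFDeriv volume 0 j
    refine h.mono' (hu.continuous_iteratedDeriv j (by exact_mod_cast le_top)).aestronglyMeasurable ?_
    refine Eventually.of_forall fun x => ?_
    simp [norm_iteratedFDeriv_eq_norm_iteratedDeriv]
  have hgi : ∀ k ≤ N, Integrable (iteratedDeriv k g) := by
    intro k hk
    have : iteratedDeriv k g = fun x => ∑ i ∈ Finset.range (k + 1),
        (k.choose i : ℂ) * iteratedDeriv i (fun y => (φ y : ℂ)) x * iteratedDeriv (k - i) u x := by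
      ext x
      exact iteratedDeriv_fun_mul (hφc.of_le (by exact_mod_cast le_top)).contDiffAt
        (hu.of_le (by exact_mod_cast le_top)).contDiffAt
    rw [this]
    refine integrable_finsetSum _ fun i hi => ?_
    rw [Finset.mem_range] at hi
    obtain ⟨C, hC⟩ := hd i (by omega)
    refine (hui (k - i)).bdd_mul (c := (k.choose i : ℝ) * C) ?_ (Eventually.of_forall fun x => ?_)
    · have := hφc.continuous_iteratedDeriv i (by exact_mod_cast le_top)
      exact Continuous.aestronglyMeasurable (by fun_prop)
    · rw [norm_mul, norm_iteratedDeriv_ofReal hφ, Complex.norm_natCast]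
      gcongr
      exact hC x
  set I0 := ∫ x, ‖g x‖
  set I1 := ∫ x, ‖iteratedDeriv N g x‖
  have hI0 : 0 ≤ I0 := integral_nonneg fun _ => norm_nonneg _
  have hI1 : 0 ≤ I1 := integral_nonneg fun _ => norm_nonneg _
  refine ⟨2 ^ (N - 1) * (I0 + I1), by positivity, fun x => ?_⟩
  have h0 : ‖FTinv g x‖ ≤ I0 := norm_FTinv_le g x
  have h1 : |x| ^ N * ‖FTinv g x‖ ≤ I1 := by
    have := norm_FT_le (iteratedDeriv N g) (-x)
    rw [FT_iteratedDeriv (N := N) (hgs.of_le (by exact_mod_cast le_top)) hgi le_rfl, norm_mul,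
      norm_pow, norm_mul, Complex.norm_I, Complex.norm_real, ← FTinv_eq] at this
    simpa using this
  unfold rr
  rw [inv_pow, ← div_eq_mul_inv, le_div_iff₀ (by positivity)]
  have h2 : Real.sqrt (1 + x ^ 2) ≤ 1 + |x| := by
    rw [Real.sqrt_le_left (by positivity)]
    nlinarith [abs_nonneg x, sq_abs x]
  have h3 : Real.sqrt (1 + x ^ 2) ^ N ≤ 2 ^ (N - 1) * (1 + |x| ^ N) := by
    calc _ ≤ (1 + |x|) ^ N := by gcongr
      _ ≤ _ := by
        have := add_pow_le zero_le_one (abs_nonneg x) N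
        simpa using this
  calc _ ≤ ‖FTinv g x‖ * (2 ^ (N - 1) * (1 + |x| ^ N)) := by gcongr
    _ = 2 ^ (N - 1) * (‖FTinv g x‖ + |x| ^ N * ‖FTinv g x‖) := by ring
    _ ≤ _ := by gcongr

lemma exists_cutoff0 : ∃ χ : ℝ → ℂ, ContDiff ℝ (⊤ : ℕ∞) χ ∧ HasCompactSupport χ ∧ χ 0 = 1 := by
  have f : ContDiffBump (0 : ℝ) := ⟨1, 2, by norm_num, by norm_num⟩
  refine ⟨fun x => (f x : ℂ), contDiff_ofReal' f.contDiff,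
    f.hasCompactSupport.comp_left (g := Complex.ofReal) (by simp), ?_⟩
  have : f 0 = 1 := f.one_of_mem_closedBall (by simpa using f.rIn_pos.le)
  simp [this]

lemma exists_cutoff : ∃ χ : ℝ → ℂ, ContDiff ℝ (⊤ : ℕ∞) χ ∧ HasCompactSupport χ ∧ χ 0 = 1 ∧
    ∃ c : ℕ → ℝ, (∀ k, 0 ≤ c k) ∧ ∀ k x, ‖iteratedDeriv k χ x‖ ≤ c k * rr x ^ k := by
  obtain ⟨χ, hs, hc, h0⟩ := exists_cutoff0
  have hb : ∀ k, ∃ c : ℝ, ∀ x, ‖iteratedDeriv k χ x * (((rr x ^ k)⁻¹ : ℝ) : ℂ)‖ ≤ c := by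
    intro k
    apply Continuous.bounded_above_of_compact_support
    · refine Continuous.mul (hs.continuous_iteratedDeriv k (by exact_mod_cast le_top)) ?_
      exact Complex.continuous_ofReal.comp
        ((rr_continuous.pow k).inv₀ fun x => (pow_pos (rr_pos x) k).ne')
    · exact (compact_iteratedDeriv hc k).mul_right
  choose c hc' using hb
  refine ⟨χ, hs, hc, h0, c, fun k => (norm_nonneg _).trans (hc' k 0), ?_⟩
  intro k x
  have := hc' k x
  have hp := pow_pos (rr_pos x) k
  rwa [norm_mul, Complex.norm_real, norm_inv, Real.norm_of_nonneg hp.le, ← div_eq_mul_inv,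
    div_le_iff₀ hp] at this
end partD

section partE
open FourierTransform
open scoped SchwartzMap

/-- Symbol-type bounds for a multiplier, relative to a weight. -/
structure SymB (p : ℝ → ℂ) (w : ℝ → ℝ) (m : ℕ) : Prop where
  smooth : ContDiff ℝ (⊤ : ℕ∞) p
  w_one : ∀ x, 1 ≤ w x
  bound : ∃ M : ℕ → ℝ, (∀ k, 0 ≤ M k) ∧ ∀ k x, ‖iteratedDeriv k p x‖ ≤ M k * w x * rr x ^ k
  growth : ∃ A : ℝ, 0 ≤ A ∧ ∀ x, w x * rr x ^ m ≤ A

lemma SymB.integrable_mul {p : ℝ → ℂ} {w : ℝ → ℝ} {m : ℕ} (hp : SymB p w m)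
    {φ : ℝ → ℝ} (hφ : ContDiff ℝ (⊤ : ℕ∞) φ) (h01 : ∀ x, 0 ≤ φ x ∧ φ x ≤ 1)
    (hd : ∀ j ≤ m + 2, ∃ C : ℝ, ∀ x, |iteratedDeriv j φ x| ≤ C) (u : 𝓢(ℝ, ℂ)) :
    Integrable (fun x => p x * FTinv (fun y => (φ y : ℂ) * u y) x) := by
  obtain ⟨M, hM, hb⟩ := hp.bound
  obtain ⟨A, hA, hg⟩ := hp.growth
  obtain ⟨C, hC, hdec⟩ := FTinv_decay hφ hd u
  refine Integrable.mono' (integrable_inv_one_add_sq.const_mul (M 0 * A * C)) ?_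
    (Eventually.of_forall fun x => ?_)
  · have h1 := hp.smooth.continuous
    have h2 := FTinv_continuous (phi_mul_integrable hφ h01 u)
    exact (h1.mul h2).aestronglyMeasurable
  · have h1 := hb 0 x
    rw [iteratedDeriv_zero, pow_zero, mul_one] at h1
    have hw : 0 ≤ w x := zero_le_one.trans (hp.w_one x)
    have hr := (rr_pos x).le
    rw [norm_mul, ← rr_sq]
    calc _ ≤ (M 0 * w x) * (C * rr x ^ (m + 2)) := by gcongr; exact mul_nonneg (hM 0) hw; exact hdec x
      _ = M 0 * (w x * rr x ^ m) * C * rr x ^ 2 := by ring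
      _ ≤ M 0 * A * C * rr x ^ 2 := by
        have := hM 0
        gcongr
        exact hg x

lemma SymB.integrable_mul_plain {p : ℝ → ℂ} {w : ℝ → ℝ} {m : ℕ} (hp : SymB p w m) (u : 𝓢(ℝ, ℂ)) :
    Integrable (fun x => p x * FTinv u x) := by
  have := hp.integrable_mul (φ := fun _ => 1) contDiff_const (fun x => by norm_num)
    (fun j _ => ⟨1, fun x => by rw [iteratedDeriv_const]; split_ifs <;> simp⟩) u
  simpa using this

lemma FT_tendsto {f : ℕ → ℝ → ℂ} {g : ℝ → ℂ} {h : ℝ → ℝ} (hf : ∀ k, AEStronglyMeasurable (f k) volume)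
    (hh : Integrable h) (hb : ∀ k x, ‖f k x‖ ≤ h x) (hl : ∀ x, Tendsto (fun k => f k x) atTop (nhds (g x)))
    (ξ : ℝ) : Tendsto (fun k => FT (f k) ξ) atTop (nhds (FT g ξ)) := by
  unfold FT
  apply Tendsto.const_mul
  refine tendsto_integral_of_dominated_convergence h (fun k => ?_) hh (fun k => ?_) ?_
  · exact AEStronglyMeasurable.mul (Continuous.aestronglyMeasurable (by fun_prop)) (hf k)
  · refine Eventually.of_forall fun x => ?_
    rw [norm_mul]
    have : ‖Complex.exp (-(Complex.I * (ξ : ℂ) * (x : ℂ)))‖ = 1 := by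
      rw [Complex.norm_exp]; simp
    rw [this, one_mul]; exact hb k x
  · exact Eventually.of_forall fun x => (hl x).const_mul _

lemma comm_general {p : ℝ → ℂ} {w : ℝ → ℝ} {m : ℕ} (hp : SymB p w m) :
    ∃ C : ℝ, 0 < C ∧ ∀ s L : ℝ, 1 ≤ s → 0 < L → ∀ φ : ℝ → ℝ, ContDiff ℝ (⊤ : ℕ∞) φ →
      (∀ x, 0 ≤ φ x ∧ φ x ≤ 1) →
      (∀ j : ℕ, 1 ≤ j → j ≤ m + 2 → ∀ x : ℝ, |iteratedDeriv j φ x| ≤ L / s ^ j) →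
      ∀ u : 𝓢(ℝ, ℂ), eLpNorm (commF p φ u) 2 volume ≤ ENNReal.ofReal (C * L / s) *
        (eLpNorm (fun x => (w x : ℂ) * FTinv u x) 2 volume + eLpNorm u 2 volume) := by
  obtain ⟨M, hM, hb⟩ := hp.bound
  obtain ⟨A, hA, hg⟩ := hp.growth
  obtain ⟨χ, hχs, hχc, hχ0, c, hc, hχb⟩ := exists_cutoff
  set M' : ℕ → ℝ := fun k => ∑ i ∈ Finset.range (k + 1), (k.choose i : ℝ) * c i * M (k - i) with hM'
  have hM'0 : ∀ k, 0 ≤ M' k := fun k => Finset.sum_nonneg fun i _ =>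
    mul_nonneg (mul_nonneg (by positivity) (hc i)) (hM _)
  have hw : ∀ x, 0 ≤ w x := fun x => zero_le_one.trans (hp.w_one x)
  set ε : ℕ → ℝ := fun k => 1 / ((k : ℝ) + 1) with hε
  have hε0 : ∀ k, 0 < ε k := fun k => by simp only [hε]; positivity
  have hε1 : ∀ k, ε k ≤ 1 := fun k => by
    simp only [hε]; rw [div_le_one (by positivity)]; linarith [(Nat.cast_nonneg k : (0 : ℝ) ≤ k)]
  set P : ℕ → ℝ → ℂ := fun k x => χ (ε k * x) * p x with hP
  have hχe : ∀ k, ContDiff ℝ (⊤ : ℕ∞) (fun x => χ (ε k * x)) := fun k =>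
    hχs.comp (contDiff_const.mul contDiff_id)
  have hPs : ∀ k, ContDiff ℝ (⊤ : ℕ∞) (P k) := fun k => (hχe k).mul hp.smooth
  have hPc : ∀ k, HasCompactSupport (P k) := by
    intro k
    have : HasCompactSupport (fun x => χ (ε k * x)) :=
      hχc.comp_homeomorph (Homeomorph.mulLeft₀ (ε k) (hε0 k).ne')
    exact this.mul_right
  have hPb : ∀ k j x, ‖iteratedDeriv j (P k) x‖ ≤ M' j * w x * rr x ^ j := by
    intro k j x
    have e : iteratedDeriv j (P k) x = ∑ i ∈ Finset.range (j + 1), (j.choose i : ℂ) *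
        iteratedDeriv i (fun y => χ (ε k * y)) x * iteratedDeriv (j - i) p x :=
      iteratedDeriv_fun_mul ((hχe k).of_le (by exact_mod_cast le_top)).contDiffAt
        (hp.smooth.of_le (by exact_mod_cast le_top)).contDiffAt
    rw [e, hM', Finset.sum_mul, Finset.sum_mul]
    refine (norm_sum_le _ _).trans (Finset.sum_le_sum fun i hi => ?_)
    rw [Finset.mem_range] at hi
    have h1 : ‖iteratedDeriv i (fun y => χ (ε k * y)) x‖ ≤ c i * rr x ^ i := by
      rw [iteratedDeriv_comp_const_smul (hχs.of_le (by exact_mod_cast le_top)), norm_smul, norm_pow,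
        Real.norm_of_nonneg (hε0 k).le]
      have hci := hc i
      have hei := (hε0 k).le
      have hri := (rr_pos (ε k * x)).le
      calc _ ≤ ε k ^ i * (c i * rr (ε k * x) ^ i) := by gcongr; exact hχb i _
        _ = c i * (ε k * rr (ε k * x)) ^ i := by rw [mul_pow]; ring
        _ ≤ c i * rr x ^ i := by
          gcongr
          exact rr_scale (hε0 k) (hε1 k) x
    rw [norm_mul, norm_mul, Complex.norm_natCast]
    have hci := hc i
    have hri := (rr_pos x).le
    calc _ ≤ (j.choose i : ℝ) * (c i * rr x ^ i) * (M (j - i) * w x * rr x ^ (j - i)) := by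
          gcongr; exact hb _ x
      _ = (j.choose i : ℝ) * c i * M (j - i) * w x * (rr x ^ i * rr x ^ (j - i)) := by ring
      _ = _ := by rw [← pow_add, show i + (j - i) = j by omega]
  -- uniform constants
  set S : ℝ := ∑ j ∈ Finset.range (m + 2), M' j with hS
  have hS0 : 0 ≤ S := Finset.sum_nonneg fun j _ => hM'0 j
  have hSj : ∀ j ≤ m + 1, M' j ≤ S := fun j hj =>
    Finset.single_le_sum (f := M') (fun i _ => hM'0 i) (Finset.mem_range.2 (by omega))
  set B : ℝ := (M' (m + 2) + M' (m + 4)) * A * Real.pi with hB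
  have hB0 : 0 ≤ B := mul_nonneg (mul_nonneg (add_nonneg (hM'0 _) (hM'0 _)) hA) Real.pi_pos.le
  have hInt : ∀ k j, m + 2 ≤ j → ∫ x, ‖iteratedDeriv j (P k) x‖ ≤ M' j * A * Real.pi := by
    intro k j hj
    rw [← integral_univ_inv_one_add_sq, ← integral_const_mul]
    refine integral_mono (integrable_iteratedDeriv (hPs k) (hPc k) j).norm
      (integrable_inv_one_add_sq.const_mul _) fun x => ?_
    have hri := (rr_pos x).le
    have h1 := hM'0 j
    have h2 := hw x
    rw [← rr_sq]
    calc _ ≤ M' j * w x * rr x ^ j := hPb k j x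
      _ ≤ M' j * w x * rr x ^ (m + 2) := by
        exact mul_le_mul_of_nonneg_left (pow_le_pow_of_le_one hri (rr_le_one x) hj) (mul_nonneg h1 h2)
      _ = M' j * (w x * rr x ^ m) * rr x ^ 2 := by ring
      _ ≤ _ := by gcongr; exact hg x
  set D : ℝ := (m + 1 : ℕ) * S + B * Real.pi + 1 with hD
  have hD1 : (m + 1 : ℕ) * S ≤ D := by have := Real.pi_pos; have : 0 ≤ B * Real.pi := by positivity
                                       linarith
  have hD2 : B * Real.pi ≤ D := by have : 0 ≤ (m + 1 : ℕ) * S := by positivity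
                                   linarith
  have hD0 : 0 < D := by have := Real.pi_pos; positivity
  refine ⟨D, hD0, fun s L hs hL φ hφ h01 hd u => ?_⟩
  have hs0 : 0 < s := by linarith
  set F := eLpNorm (fun x => (w x : ℂ) * FTinv u x) 2 volume with hF
  have hbound : ∀ k, eLpNorm (commF (P k) φ u) 2 volume ≤
      ENNReal.ofReal (D * L / s) * (F + eLpNorm u 2 volume) := by
    intro k
    have h := comm_compact (n := m + 1) (hPs k) (hPc k) hφ h01 hs hL.le hd u
      (W := ENNReal.ofReal S * F) (B := B) ?_ ?_
    · refine h.trans ?_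
      have e1 : ((m + 1 : ℕ) : ℝ≥0∞) * (ENNReal.ofReal S * F) ≤ ENNReal.ofReal D * F := by
        rw [← mul_assoc]
        gcongr
        rw [← ENNReal.ofReal_natCast, ← ENNReal.ofReal_mul (by positivity)]
        exact ENNReal.ofReal_le_ofReal hD1
      have e2 : ENNReal.ofReal (D * L / s) = ENNReal.ofReal (L / s) * ENNReal.ofReal D := by
        rw [← ENNReal.ofReal_mul (by positivity)]; congr 1; ring
      rw [e2, mul_assoc (ENNReal.ofReal (L / s)), mul_add (ENNReal.ofReal D)]
      refine mul_le_mul' le_rfl (add_le_add e1 ?_)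
      gcongr
    · intro j hj1 hj2
      refine (eLpNorm_le_mul_eLpNorm_of_ae_le_mul (c := S) (Eventually.of_forall fun x => ?_) 2)
      rw [norm_mul, norm_mul, Complex.norm_real, Real.norm_of_nonneg (hw x), ← mul_assoc]
      gcongr
      have h2 := hw x
      calc _ ≤ M' j * w x * rr x ^ j := hPb k j x
        _ ≤ S * w x * 1 := by
          have := (rr_pos x).le
          gcongr
          · exact hSj j hj2
          · exact pow_le_one₀ this (rr_le_one x)
        _ = _ := mul_one _
    · have := hInt k (m + 2) le_rfl
      have h2 := hInt k (m + 4) (by omega)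
      calc _ ≤ _ := add_le_add this h2
        _ = B := by rw [hB]; ring
  have hφd : ∀ j ≤ m + 2, ∃ C : ℝ, ∀ x, |iteratedDeriv j φ x| ≤ C := by
    intro j hj
    rcases Nat.eq_zero_or_pos j with rfl | h
    · exact ⟨1, fun x => by
        rw [iteratedDeriv_zero, abs_of_nonneg (h01 x).1]; exact (h01 x).2⟩
    · exact ⟨_, hd j h hj⟩
  have hχlim : ∀ x, Tendsto (fun k => P k x) atTop (nhds (p x)) := by
    intro x
    have h1 : Tendsto (fun k => ε k * x) atTop (nhds 0) := by
      have h := (tendsto_one_div_add_atTop_nhds_zero_nat (𝕜 := ℝ)).mul_const x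
      rw [zero_mul] at h
      exact h
    have h2 := (hχs.continuous.tendsto 0).comp h1
    rw [hχ0] at h2
    simpa using h2.mul_const (p x)
  have hχ1 : ∀ x, ‖χ x‖ ≤ c 0 := fun x => by simpa using hχb 0 x
  have hlim : ∀ {g : ℝ → ℂ}, Integrable g → Integrable (fun x => p x * FTinv g x) → ∀ ξ,
      Tendsto (fun k => FT (fun x => P k x * FTinv g x) ξ) atTop
        (nhds (FT (fun x => p x * FTinv g x) ξ)) := by
    intro g hg1 hg2 ξ
    refine FT_tendsto (h := fun x => c 0 * ‖p x * FTinv g x‖) (fun k => ?_) (hg2.norm.const_mul _)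
      (fun k x => ?_) (fun x => (hχlim x).mul_const _) ξ
    · exact ((hPs k).continuous.mul (FTinv_continuous hg1)).aestronglyMeasurable
    · simp only [hP]
      rw [mul_assoc, norm_mul]
      gcongr
      exact hχ1 _
  have hfin := Lp.eLpNorm_lim_le_liminf_eLpNorm (μ := volume) (p := 2)
    (f := fun k => commF (P k) φ u) (fun k => (commF_measurable (by
      simpa using integrable_iteratedDeriv (hPs k) (hPc k) 0) hφ h01 u).aestronglyMeasurable)
    (commF p φ u) (Eventually.of_forall fun ξ => by
      unfold commF
      exact (hlim (phi_mul_integrable hφ h01 u) (hp.integrable_mul hφ h01 hφd u) ξ).sub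
        ((hlim u.integrable (hp.integrable_mul_plain u) ξ).const_mul _))
  refine hfin.trans ?_
  refine (liminf_le_liminf (Eventually.of_forall hbound)).trans ?_
  rw [liminf_const]
end partE

section partF
open FourierTransform
open scoped SchwartzMap

lemma rr_rpow (x : ℝ) (n : ℕ) : (1 + x ^ 2) ^ (-(n : ℝ) / 2) = rr x ^ n := by
  unfold rr
  rw [inv_pow, Real.sqrt_eq_rpow, ← Real.rpow_natCast _ n, ← Real.rpow_mul (by positivity),
    ← Real.rpow_neg (by positivity)]
  congr 1; ring

lemma growth_bound {a : ℝ → ℝ} (hs : ContDiff ℝ (⊤ : ℕ∞) a) (ha : ∀ x, 0 ≤ a x) {C : ℝ}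
    (hd : ∀ x, |deriv a x| ≤ C * (1 + a x) * rr x) {m : ℕ} (hm : C ≤ m) (x : ℝ) :
    (1 + a x) * rr x ^ m ≤ (1 + a 0) * 2 ^ m := by
  have hpos : ∀ x, 0 < 1 + a x := fun x => by linarith [ha x]
  have hdiff : ∀ x, HasDerivAt a (deriv a x) x := fun x =>
    (hs.differentiable (by simp) x).hasDerivAt
  have hlog : ∀ x, HasDerivAt (fun y => Real.log (1 + a y)) (deriv a x / (1 + a x)) x := fun x =>
    ((hdiff x).const_add 1).log (hpos x).ne'
  have hb : ∀ x, |deriv a x / (1 + a x)| ≤ m * rr x := by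
    intro x
    rw [abs_div, abs_of_pos (hpos x), div_le_iff₀ (hpos x)]
    have := rr_pos x
    calc _ ≤ C * (1 + a x) * rr x := hd x
      _ ≤ m * (1 + a x) * rr x := by have := hpos x; gcongr
      _ = _ := by ring
  have har : ∀ x, HasDerivAt (fun y => (m : ℝ) * Real.arsinh y) (m * rr x) x := fun x =>
    (Real.hasDerivAt_arsinh x).const_mul _
  have hmono : Monotone (fun y => m * Real.arsinh y + Real.log (1 + a y)) := by
    apply monotone_of_hasDerivAt_nonneg (fun x => (har x).add (hlog x))
    intro x
    have := (abs_le.1 (hb x)).1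
    simp only [Pi.zero_apply]; linarith
  have hmono2 : Monotone (fun y => m * Real.arsinh y - Real.log (1 + a y)) := by
    apply monotone_of_hasDerivAt_nonneg (fun x => (har x).sub (hlog x))
    intro x
    have := (abs_le.1 (hb x)).2
    simp only [Pi.zero_apply]; linarith
  have key : Real.log (1 + a x) ≤ Real.log (1 + a 0) + m * Real.arsinh |x| := by
    rcases le_total 0 x with h | h
    · have := hmono2 h
      rw [abs_of_nonneg h]
      simp only [Real.arsinh_zero, mul_zero] at this
      linarith
    · have := hmono h
      rw [abs_of_nonpos h, Real.arsinh_neg]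
      simp only [Real.arsinh_zero, mul_zero] at this
      linarith
  have key2 : 1 + a x ≤ (1 + a 0) * (Real.exp (Real.arsinh |x|)) ^ m := by
    rw [← Real.exp_log (hpos x), ← Real.exp_nat_mul]
    nth_rw 1 [← Real.exp_log (hpos 0)]
    rw [← Real.exp_add]
    exact Real.exp_le_exp.2 key
  have key3 : Real.exp (Real.arsinh |x|) * rr x ≤ 2 := by
    rw [Real.exp_arsinh, sq_abs, rr, ← div_eq_mul_inv, div_le_iff₀ (by positivity)]
    have : |x| ≤ Real.sqrt (1 + x ^ 2) := Real.abs_le_sqrt (by linarith)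
    linarith
  have hr := (rr_pos x).le
  have := hpos 0
  calc (1 + a x) * rr x ^ m ≤ (1 + a 0) * (Real.exp (Real.arsinh |x|)) ^ m * rr x ^ m := by gcongr
    _ = (1 + a 0) * (Real.exp (Real.arsinh |x|) * rr x) ^ m := by rw [mul_pow]; ring
    _ ≤ _ := by gcongr

lemma standing_symB {a q : ℝ → ℝ} (h : Standing a q) : ∃ m : ℕ,
    SymB (fun x => (a x : ℂ)) (fun x => 1 + a x) m ∧ SymB (fun x => (q x : ℂ)) (fun x => 1 + a x) m := by
  have hda := h.deriv_a
  have hdq := h.deriv_q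
  simp only [rr_rpow] at hda hdq
  choose! Ca hCa0 hCa using hda
  choose! Cq hCq0 hCq using hdq
  obtain ⟨m, hm⟩ := exists_nat_ge (Ca 1)
  have hgr : ∃ A : ℝ, 0 ≤ A ∧ ∀ x, (1 + a x) * rr x ^ m ≤ A := by
    refine ⟨(1 + a 0) * 2 ^ m, by have := h.nonneg_a 0; positivity,
      growth_bound h.smooth_a h.nonneg_a (C := Ca 1) (fun x => ?_) hm⟩
    have := hCa 1 le_rfl x
    rwa [iteratedDeriv_one, pow_one] at this
  have hw1 : ∀ x, 1 ≤ 1 + a x := fun x => by linarith [h.nonneg_a x]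
  have hq : ∃ D : ℝ, 0 ≤ D ∧ ∀ x, q x ≤ D * (1 + a x) := by
    obtain ⟨K, hK, x₀, hx₀, hqa⟩ := h.q_le_a
    obtain ⟨B, hB⟩ := (isCompact_Icc (a := -x₀) (b := x₀)).exists_bound_of_continuousOn
      h.smooth_q.continuous.continuousOn
    have hB0 : 0 ≤ B := (norm_nonneg _).trans (hB 0 ⟨by linarith, by linarith⟩)
    refine ⟨K + B, by linarith, fun x => ?_⟩
    have ha := h.nonneg_a x
    by_cases hx : x₀ < |x|
    · have := hqa x hx
      nlinarith [mul_nonneg hB0 ha]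
    · have := hB x (abs_le.1 (not_lt.1 hx))
      rw [Real.norm_of_nonneg (h.nonneg_q x)] at this
      nlinarith [mul_nonneg hB0 ha, mul_nonneg hK.le ha]
  obtain ⟨D, hD, hqD⟩ := hq
  refine ⟨m, ⟨contDiff_ofReal' h.smooth_a, hw1, ⟨fun k => if k = 0 then 1 else Ca k, ?_, ?_⟩, hgr⟩,
    ⟨contDiff_ofReal' h.smooth_q, hw1, ⟨fun k => if k = 0 then D else Cq k * (1 + D), ?_, ?_⟩, hgr⟩⟩
  · intro k
    beta_reduce
    split_ifs with hk
    · norm_num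
    · exact (hCa0 k (by omega)).le
  · intro k x
    rw [norm_iteratedDeriv_ofReal h.smooth_a]
    beta_reduce
    split_ifs with hk
    · subst hk
      rw [iteratedDeriv_zero, abs_of_nonneg (h.nonneg_a x)]; simp
    · exact hCa k (by omega) x
  · intro k
    beta_reduce
    split_ifs with hk
    · exact hD
    · have := hCq0 k (by omega); positivity
  · intro k x
    rw [norm_iteratedDeriv_ofReal h.smooth_q]
    beta_reduce
    split_ifs with hk
    · subst hk
      rw [iteratedDeriv_zero, abs_of_nonneg (h.nonneg_q x)]; simpa using hqD x
    · refine (hCq k (by omega) x).trans ?_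
      have h1 := (hCq0 k (by omega)).le
      have h2 := (rr_pos x).le
      have h3 : 1 + q x ≤ (1 + D) * (1 + a x) := by linarith [hqD x, h.nonneg_a x]
      calc Cq k * (1 + q x) * rr x ^ k ≤ Cq k * ((1 + D) * (1 + a x)) * rr x ^ k := by gcongr
        _ = _ := by ring

lemma SymB.temperate {p : ℝ → ℂ} {w : ℝ → ℝ} {m : ℕ} (hp : SymB p w m) :
    Function.HasTemperateGrowth p := by
  obtain ⟨M, hM, hb⟩ := hp.bound
  obtain ⟨A, hA, hg⟩ := hp.growth
  refine ⟨hp.smooth, fun n => ⟨m, M n * A, fun x => ?_⟩⟩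
  rw [norm_iteratedFDeriv_eq_norm_iteratedDeriv]
  have hw : 0 ≤ w x := zero_le_one.trans (hp.w_one x)
  have hr := rr_pos x
  have h1 : w x ≤ A * (1 + ‖x‖) ^ m := by
    have h2 : 1 ≤ rr x * (1 + ‖x‖) := by
      rw [rr, inv_mul_eq_div, one_le_div (by positivity), Real.sqrt_le_left (by positivity)]
      rw [Real.norm_eq_abs]
      nlinarith [abs_nonneg x, sq_abs x]
    calc w x = w x * 1 := (mul_one _).symm
      _ ≤ w x * (rr x * (1 + ‖x‖)) ^ m := by gcongr; exact one_le_pow₀ h2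
      _ = w x * rr x ^ m * (1 + ‖x‖) ^ m := by rw [mul_pow]; ring
      _ ≤ _ := by gcongr; exact hg x
  have := hM n
  calc _ ≤ M n * w x * rr x ^ n := hb n x
    _ ≤ M n * w x * 1 := by gcongr; exact pow_le_one₀ hr.le (rr_le_one x)
    _ = M n * w x := mul_one _
    _ ≤ M n * (A * (1 + ‖x‖) ^ m) := by gcongr
    _ = _ := by ring
end partF

section partG
open FourierTransform
open scoped SchwartzMap ComplexConjugate

/-- Abstract form of the energy estimate. -/
lemma energy {H : Type*} [NormedAddCommGroup H] [InnerProductSpace ℂ H]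
    {t u u1 u2 au qu a1u au1 : H} {c b C1 : ℝ} (hc : 0 ≤ c) (hb : 1 ≤ b) (hC1 : 0 ≤ C1)
    (ht : t = -u2 + qu + (2 * (-(c : ℂ) + Complex.I * b)) • au + ((-(c : ℂ) + Complex.I * b) ^ 2) • u)
    (h1 : inner ℂ u u2 = -inner ℂ u1 u1)
    (h2 : inner ℂ au u2 = -(inner ℂ a1u u1 + inner ℂ au1 u1))
    (r1 : (inner ℂ u qu).im = 0) (r1' : 0 ≤ (inner ℂ u qu).re)
    (r2 : (inner ℂ u au).im = 0) (r3 : (inner ℂ au qu).im = 0) (r4 : (inner ℂ au1 u1).im = 0)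
    (hC : ‖a1u‖ ≤ C1 * (‖u‖ + ‖au‖)) :
    ‖au‖ ≤ (1 + 2 * (C1 * (2 + 2 * c)) + 2 * c) * (b⁻¹ * ‖t‖ + ‖u‖) := by
  have hb0 : 0 < b := by linarith
  set X := b⁻¹ * ‖t‖ + ‖u‖ with hX
  have hX0 : 0 ≤ X := by positivity
  have hu : ‖u‖ ≤ X := by have : 0 ≤ b⁻¹ * ‖t‖ := by positivity
                          linarith
  have htX : ‖t‖ ≤ b * X := by
    rw [hX, mul_add, ← mul_assoc, mul_inv_cancel₀ hb0.ne', one_mul]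
    have : 0 ≤ b * ‖u‖ := by positivity
    linarith
  have cs : ∀ x y : H, |(inner ℂ x y).re| ≤ ‖x‖ * ‖y‖ ∧ |(inner ℂ x y).im| ≤ ‖x‖ * ‖y‖ := fun x y =>
    ⟨(Complex.abs_re_le_norm _).trans (norm_inner_le_norm x y),
      (Complex.abs_im_le_norm _).trans (norm_inner_le_norm x y)⟩
  have self : ∀ x : H, (inner ℂ x x).re = ‖x‖ ^ 2 ∧ (inner ℂ x x).im = 0 := fun x => by
    rw [inner_self_eq_norm_sq_to_K]; norm_cast
  have r2' : (inner ℂ au u).im = 0 := by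
    rw [← inner_conj_symm, Complex.conj_im, r2, neg_zero]
  have e1 : inner ℂ u t = -inner ℂ u u2 + inner ℂ u qu + 2 * (-(c : ℂ) + Complex.I * b) * inner ℂ u au
      + (-(c : ℂ) + Complex.I * b) ^ 2 * inner ℂ u u := by
    rw [ht, inner_add_right, inner_add_right, inner_add_right, inner_neg_right, inner_smul_right,
      inner_smul_right]
  have e2 : inner ℂ au t = -inner ℂ au u2 + inner ℂ au qu + 2 * (-(c : ℂ) + Complex.I * b) * inner ℂ au au
      + (-(c : ℂ) + Complex.I * b) ^ 2 * inner ℂ au u := by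
    rw [ht, inner_add_right, inner_add_right, inner_add_right, inner_neg_right, inner_smul_right,
      inner_smul_right]
  rw [h1] at e1
  rw [h2] at e2
  have e1re := congrArg Complex.re e1
  have e1im := congrArg Complex.im e1
  have e2im := congrArg Complex.im e2
  simp [pow_two, (self _).1, (self _).2, r1, r2, r3, r4, r2', -inner_self_eq_norm_sq_to_K] at e1re e1im e2im
  set g := (inner ℂ u au).re with hg
  have k1 := (abs_le.1 (cs u t).1).2
  have k2 := (abs_le.1 (cs u t).2).2
  have k3 := (abs_le.1 (cs au t).2).2
  have k4 := (abs_le.1 (cs a1u u1).2).1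
  have k5 := (abs_le.1 (cs au u).1).2
  have hut : ‖u‖ * ‖t‖ ≤ b * X ^ 2 := by
    calc _ ≤ X * (b * X) := by gcongr
      _ = _ := by ring
  have huu : ‖u‖ * ‖u‖ ≤ X ^ 2 := by rw [pow_two]; gcongr
  have hcb : 0 ≤ c * b := by positivity
  have hgb : 2 * g ≤ (1 + 2 * c) * X ^ 2 := by
    have : b * (2 * g) ≤ b * ((1 + 2 * c) * X ^ 2) := by
      have := mul_le_mul_of_nonneg_left huu hcb
      linarith
    exact le_of_mul_le_mul_left this hb0
  have hu1 : ‖u1‖ ≤ b * X * (2 + 2 * c) := by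
    apply (pow_le_pow_iff_left₀ (norm_nonneg _) (by positivity) two_ne_zero).1
    have hb1 : b ≤ b ^ 2 := le_self_pow₀ hb two_ne_zero
    have hb2 : b * X ^ 2 ≤ b ^ 2 * X ^ 2 := by gcongr
    have hb3 : X ^ 2 ≤ b ^ 2 * X ^ 2 := le_mul_of_one_le_left (sq_nonneg X) (one_le_pow₀ hb)
    have s1 : ‖u1‖ ^ 2 ≤ b * X ^ 2 + c * ((1 + 2 * c) * X ^ 2) + b ^ 2 * X ^ 2 := by
      have t1 := mul_le_mul_of_nonneg_left hgb hc
      have t2 := mul_le_mul_of_nonneg_left huu (sq_nonneg b)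
      have t3 := mul_nonneg (sq_nonneg c) (mul_self_nonneg ‖u‖)
      linarith
    have s2 : c * (1 + 2 * c) * X ^ 2 ≤ c * (1 + 2 * c) * (b ^ 2 * X ^ 2) :=
      mul_le_mul_of_nonneg_left hb3 (by positivity)
    have s3 : 0 ≤ (2 + 7 * c + 2 * c ^ 2) * (b ^ 2 * X ^ 2) := by positivity
    linarith
  by_contra hcon
  rw [not_le] at hcon
  set D := C1 * (2 + 2 * c) with hD
  have hD0 : 0 ≤ D := by positivity
  have hXY : X < ‖au‖ := by
    refine lt_of_le_of_lt ?_ hcon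
    have w1 := mul_nonneg hD0 hX0
    have w2 := mul_nonneg hc hX0
    linarith
  have hY0 : 0 < ‖au‖ := lt_of_le_of_lt hX0 hXY
  have m1 : ‖au‖ * ‖t‖ ≤ ‖au‖ * (b * X) := by gcongr
  have m2 : ‖a1u‖ * ‖u1‖ ≤ (C1 * (2 * ‖au‖)) * (b * X * (2 + 2 * c)) := by
    apply mul_le_mul _ hu1 (norm_nonneg _) (by positivity)
    refine hC.trans ?_
    gcongr
    linarith
  have m3 : ‖au‖ * ‖u‖ ≤ ‖au‖ * X := by gcongr
  have m4 : 2 * b * (‖au‖ * ‖au‖) ≤ ‖au‖ * (b * X) + (C1 * (2 * ‖au‖)) * (b * X * (2 + 2 * c))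
      + 2 * (c * b) * (‖au‖ * X) := by
    have := mul_le_mul_of_nonneg_left (k5.trans m3) hcb
    linarith
  have m5 : (b * ‖au‖) * (2 * ‖au‖) ≤ (b * ‖au‖) * ((1 + 2 * D + 2 * c) * X) := by
    rw [hD]; linarith
  have m6 := le_of_mul_le_mul_left m5 (by positivity)
  linarith

lemma eLpNorm_eq_toLp (f : 𝓢(ℝ, ℂ)) : eLpNorm f 2 volume = ENNReal.ofReal ‖f.toLp 2 volume‖ := by
  rw [SchwartzMap.norm_toLp, ENNReal.ofReal_toReal (f.memLp 2 volume).eLpNorm_ne_top]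

lemma inner_deriv (f g : 𝓢(ℝ, ℂ)) :
    inner ℂ (f.toLp 2 volume) ((SchwartzMap.derivCLM ℂ ℂ g).toLp 2 volume) =
      -inner ℂ ((SchwartzMap.derivCLM ℂ ℂ f).toLp 2 volume) (g.toLp 2 volume) := by
  rw [SchwartzMap.inner_toL2_toL2_eq _ _ volume, SchwartzMap.inner_toL2_toL2_eq _ _ volume]
  have := SchwartzMap.integral_bilinear_deriv_right_eq_neg_left f g
    ((ContinuousLinearMap.mul ℝ ℂ).comp (Complex.conjCLE : ℂ →L[ℝ] ℂ))
  simpa [mul_comm] using this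

lemma inner_im_zero (f g : 𝓢(ℝ, ℂ)) (r : ℝ → ℝ) (v : ℝ → ℝ)
    (hfg : ∀ x, conj (f x) * g x = ((r x : ℝ) : ℂ)) (hv : ∀ x, v x = r x) :
    (inner ℂ (f.toLp 2 volume) (g.toLp 2 volume)) = ((∫ x, v x : ℝ) : ℂ) := by
  rw [SchwartzMap.inner_toL2_toL2_eq _ _ volume, ← integral_complex_ofReal]
  congr 1
  ext x
  rw [hv, ← hfg]
  simp [mul_comm]

lemma energy_schwartz {a q : ℝ → ℝ} (h : Standing a q) {m : ℕ}
    (ha : SymB (fun x => (a x : ℂ)) (fun x => 1 + a x) m)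
    (hq : SymB (fun x => (q x : ℂ)) (fun x => 1 + a x) m) : ∃ C1 : ℝ, 0 ≤ C1 ∧
    ∀ c b : ℝ, 0 ≤ c → 1 ≤ b → ∀ U : 𝓢(ℝ, ℂ),
      eLpNorm (fun x => (a x : ℂ) * U x) 2 volume ≤
        ENNReal.ofReal (1 + 2 * (C1 * (2 + 2 * c)) + 2 * c) *
          (ENNReal.ofReal b⁻¹ * eLpNorm (Tq a q (-(c : ℂ) + Complex.I * (b : ℂ)) U) 2 volume
            + eLpNorm U 2 volume) := by
  obtain ⟨C1, hC1, hd⟩ := h.deriv_a 1 le_rfl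
  simp only [rr_rpow, iteratedDeriv_one, pow_one] at hd
  refine ⟨C1, hC1.le, fun c b hc hb U => ?_⟩
  have hb0 : 0 < b := by linarith
  set Am := SchwartzMap.smulLeftCLM ℂ (fun x => (a x : ℂ)) with hAm
  set Qm := SchwartzMap.smulLeftCLM ℂ (fun x => (q x : ℂ)) with hQm
  set Dm : 𝓢(ℝ, ℂ) →L[ℂ] 𝓢(ℝ, ℂ) := SchwartzMap.derivCLM ℂ ℂ with hDm
  have hAa : ∀ (f : 𝓢(ℝ, ℂ)) x, Am f x = (a x : ℂ) * f x := fun f x => by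
    rw [hAm, SchwartzMap.smulLeftCLM_apply_apply ha.temperate, smul_eq_mul]
  have hQa : ∀ (f : 𝓢(ℝ, ℂ)) x, Qm f x = (q x : ℂ) * f x := fun f x => by
    rw [hQm, SchwartzMap.smulLeftCLM_apply_apply hq.temperate, smul_eq_mul]
  have hDa : ∀ (f : 𝓢(ℝ, ℂ)) x, Dm f x = deriv f x := fun f x => by
    rw [hDm, SchwartzMap.derivCLM_apply]
  have hDc : ∀ f : 𝓢(ℝ, ℂ), ⇑(Dm f) = deriv f := fun f => funext (hDa f)
  set A1 : 𝓢(ℝ, ℂ) := Dm (Am U) - Am (Dm U) with hA1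
  have hA1a : ∀ x, A1 x = ((deriv a x : ℝ) : ℂ) * U x := by
    intro x
    have h1 : HasDerivAt a (deriv a x) x := (h.smooth_a.differentiable (by simp) x).hasDerivAt
    have h2 : HasDerivAt (Am U) (((deriv a x : ℝ) : ℂ) * U x + (a x : ℂ) * deriv U x) x := by
      have e : ⇑(Am U) = fun y => (a y : ℂ) * U y := funext (hAa U)
      rw [e]
      exact h1.ofReal_comp.mul (U.hasDerivAt x)
    rw [hA1, sub_apply, hDa, h2.deriv, hAa, hDa]
    ring
  set lam : ℂ := -(c : ℂ) + Complex.I * (b : ℂ) with hlam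
  set T : 𝓢(ℝ, ℂ) := -Dm (Dm U) + Qm U + (2 * lam) • Am U + (lam ^ 2) • U with hT
  have hTa : Tq a q lam U = T := by
    ext x
    rw [hT, Tq, add_apply, add_apply, add_apply,
      neg_apply, smul_apply, smul_apply, hDa, hDc, hQa, hAa,
      smul_eq_mul, smul_eq_mul]
    ring
  set J : 𝓢(ℝ, ℂ) →L[ℂ] Lp ℂ 2 (volume : Measure ℝ) := SchwartzMap.toLpCLM ℂ ℂ 2 volume with hJ
  have hJa : ∀ f, f.toLp 2 volume = J f := fun f => rfl
  have hreal : ∀ z : ℂ, conj z * z = ((‖z‖ ^ 2 : ℝ) : ℂ) := fun z => by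
    rw [mul_comm, Complex.mul_conj, Complex.normSq_eq_norm_sq]
  have key := energy (H := Lp ℂ 2 (volume : Measure ℝ)) (t := J T) (u := J U) (u1 := J (Dm U))
    (u2 := J (Dm (Dm U))) (au := J (Am U)) (qu := J (Qm U)) (a1u := J A1) (au1 := J (Am (Dm U)))
    (c := c) (b := b) (C1 := C1) hc hb hC1.le
    (by rw [hT, map_add, map_add, map_add, map_neg, map_smul, map_smul])
    (inner_deriv U (Dm U))
    (by
      rw [← inner_add_left, ← map_add, hA1, sub_add_cancel]
      exact inner_deriv (Am U) (Dm U))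
    (by
      rw [← hJa, ← hJa, inner_im_zero U (Qm U) (fun x => q x * ‖U x‖ ^ 2) _ (fun x => ?_)
        (fun x => rfl), Complex.ofReal_im]
      rw [hQa, mul_left_comm, hreal]; push_cast; ring)
    (by
      rw [← hJa, ← hJa, inner_im_zero U (Qm U) (fun x => q x * ‖U x‖ ^ 2) _ (fun x => ?_)
        (fun x => rfl), Complex.ofReal_re]
      · exact integral_nonneg fun x => mul_nonneg (h.nonneg_q x) (by positivity)
      · rw [hQa, mul_left_comm, hreal]; push_cast; ring)
    (by
      rw [← hJa, ← hJa, inner_im_zero U (Am U) (fun x => a x * ‖U x‖ ^ 2) _ (fun x => ?_)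
        (fun x => rfl), Complex.ofReal_im]
      rw [hAa, mul_left_comm, hreal]; push_cast; ring)
    (by
      rw [← hJa, ← hJa, inner_im_zero (Am U) (Qm U) (fun x => a x * q x * ‖U x‖ ^ 2) _ (fun x => ?_)
        (fun x => rfl), Complex.ofReal_im]
      rw [hAa, hQa, map_mul, Complex.conj_ofReal, mul_assoc, mul_left_comm (conj (U x)), hreal]
      push_cast; ring)
    (by
      rw [← hJa, ← hJa, inner_im_zero (Am (Dm U)) (Dm U) (fun x => a x * ‖Dm U x‖ ^ 2) _ (fun x => ?_)
        (fun x => rfl), Complex.ofReal_im]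
      rw [hAa, map_mul, Complex.conj_ofReal, mul_assoc, hreal]
      push_cast; ring)
    (by
      have e : eLpNorm A1 2 volume ≤ ENNReal.ofReal C1 * eLpNorm (U + Am U) 2 volume := by
        refine eLpNorm_le_mul_eLpNorm_of_ae_le_mul (Eventually.of_forall fun x => ?_) 2
        have hp : (0 : ℝ) ≤ 1 + a x := by linarith [h.nonneg_a x]
        have e1 : (U + Am U) x = ((1 + a x : ℝ) : ℂ) * U x := by
          rw [add_apply, hAa]; push_cast; ring
        rw [e1, hA1a, norm_mul, norm_mul, Complex.norm_real, Complex.norm_real,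
          Real.norm_of_nonneg hp, Real.norm_eq_abs, ← mul_assoc]
        gcongr
        refine (hd x).trans ?_
        have := rr_le_one x
        have h0 : 0 ≤ C1 * (1 + a x) := by positivity
        nlinarith
      rw [eLpNorm_eq_toLp, eLpNorm_eq_toLp, ← ENNReal.ofReal_mul hC1.le,
        ENNReal.ofReal_le_ofReal_iff (by positivity), hJa, hJa, map_add] at e
      exact e.trans (by gcongr; exact norm_add_le _ _))
  have hAU : (fun x => (a x : ℂ) * U x) = ⇑(Am U) := (funext (hAa U)).symm
  rw [hAU, hTa, eLpNorm_eq_toLp, eLpNorm_eq_toLp, eLpNorm_eq_toLp, ← ENNReal.ofReal_mul (by positivity),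
    ← ENNReal.ofReal_add (by positivity) (by positivity), ← ENNReal.ofReal_mul (by positivity)]
  exact ENNReal.ofReal_le_ofReal key
end partG

section partH
open FourierTransform
open scoped SchwartzMap

lemma FT_add_mul {f g : ℝ → ℂ} (hf : Integrable f) (hg : Integrable g) (z : ℂ) (ξ : ℝ) :
    FT (fun x => f x + z * g x) ξ = FT f ξ + z * FT g ξ := by
  have hi : ∀ {k : ℝ → ℂ}, Integrable k →
      Integrable (fun x : ℝ => Complex.exp (-(Complex.I * (ξ : ℂ) * (x : ℂ))) * k x) := by
    intro k hk
    refine hk.bdd_mul (c := 1) (Continuous.aestronglyMeasurable (by fun_prop))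
      (Eventually.of_forall fun x => ?_)
    rw [Complex.norm_exp]; simp
  unfold FT
  have : (fun x : ℝ => Complex.exp (-(Complex.I * (ξ : ℂ) * (x : ℂ))) * (f x + z * g x)) =
      fun x : ℝ => Complex.exp (-(Complex.I * (ξ : ℂ) * (x : ℂ))) * f x +
        z * (Complex.exp (-(Complex.I * (ξ : ℂ) * (x : ℂ))) * g x) := by
    ext x; ring
  rw [this, integral_add (hi hf) ((hi hg).const_mul z), integral_const_mul]
  ring

lemma SymB.commF_continuous {p : ℝ → ℂ} {w : ℝ → ℝ} {m : ℕ} (hp : SymB p w m)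
    {φ : ℝ → ℝ} (hφ : ContDiff ℝ (⊤ : ℕ∞) φ) (h01 : ∀ x, 0 ≤ φ x ∧ φ x ≤ 1)
    (hd : ∀ j ≤ m + 2, ∃ C : ℝ, ∀ x, |iteratedDeriv j φ x| ≤ C) (u : 𝓢(ℝ, ℂ)) :
    Continuous (commF p φ u) := by
  have h1 := FT_continuous (hp.integrable_mul hφ h01 hd u)
  have h2 := FT_continuous (hp.integrable_mul_plain u)
  have := hφ.continuous
  unfold commF
  fun_prop

end partH

theorem stmt9 (a q : ℝ → ℝ) (h : Standing a q) :
    ∃ N : ℕ, ∀ K : Set ℝ, Bornology.IsBounded K → K ⊆ Set.Ici 0 →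
      ∀ δ : ℝ, δ ∈ Set.Ioo (0 : ℝ) (1 / 4) → ∀ Λ : ℝ, 0 < Λ →
        ∃ C : ℝ, 0 < C ∧ ∃ b₀ : ℝ, 0 < b₀ ∧ ∀ c ∈ K, ∀ b : ℝ, b₀ ≤ b →
          ∀ φ : ℝ → ℝ, ContDiff ℝ (⊤ : ℕ∞) φ → (∀ x, 0 ≤ φ x ∧ φ x ≤ 1) →
            (∀ j : ℕ, 1 ≤ j → j ≤ N → ∀ x : ℝ, |iteratedDeriv j φ x| ≤ Λ / (δ * b) ^ j) →
            ∀ u : SchwartzMap ℝ ℂ,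
              eLpNorm (fun ξ : ℝ =>
                  FT (fun x => ((q x : ℂ) + 2 * (-(c : ℂ) + Complex.I * (b : ℂ)) * (a x : ℂ)) *
                      FTinv (fun y => (φ y : ℂ) * u y) x) ξ
                    - (φ ξ : ℂ) *
                      FT (fun x => ((q x : ℂ) + 2 * (-(c : ℂ) + Complex.I * (b : ℂ)) * (a x : ℂ)) *
                        FTinv (⇑u) x) ξ) 2 volume
                ≤ ENNReal.ofReal C *
                    (ENNReal.ofReal b⁻¹ *
                        eLpNorm (Tq a q (-(c : ℂ) + Complex.I * (b : ℂ)) (FTinv (⇑u))) 2 volume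
                      + eLpNorm (⇑u) 2 volume) := by
  obtain ⟨m, ha, hq⟩ := standing_symB h
  obtain ⟨Ca, hCa, hca⟩ := comm_general ha
  obtain ⟨Cq, hCq, hcq⟩ := comm_general hq
  obtain ⟨C1, hC1, hen⟩ := energy_schwartz h ha hq
  refine ⟨m + 2, fun K hK hK0 δ hδ Λ hΛ => ?_⟩
  obtain ⟨R', hR'⟩ := hK.exists_norm_le
  set R : ℝ := max R' 0 with hR
  have hR0 : 0 ≤ R := le_max_right _ _
  have hδ0 : 0 < δ := hδ.1
  set E : ℝ := 1 + 2 * (C1 * (2 + 2 * R)) + 2 * R with hE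
  have hE0 : 0 ≤ E := by positivity
  set D : ℝ := Cq * Λ / δ + 2 * (R + 1) * (Ca * Λ / δ) with hD
  have hD0 : 0 < D := by positivity
  refine ⟨D * (E + 2), by positivity, max 1 (1 / δ), by positivity, ?_⟩
  intro c hc b hb φ hφ h01 hd u
  have hb1 : 1 ≤ b := (le_max_left _ _).trans hb
  have hb0 : 0 < b := by linarith
  have hs : 1 ≤ δ * b := by
    have := (le_max_right 1 (1 / δ)).trans hb
    rwa [div_le_iff₀ hδ0, mul_comm] at this
  have hc0 : 0 ≤ c := hK0 hc
  have hcR : c ≤ R := ((le_abs_self c).trans (hR' c hc)).trans (le_max_left _ _)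
  have hφd : ∀ j ≤ m + 2, ∃ C : ℝ, ∀ x, |iteratedDeriv j φ x| ≤ C := by
    intro j hj
    rcases Nat.eq_zero_or_pos j with rfl | h
    · exact ⟨1, fun x => by
        rw [iteratedDeriv_zero, abs_of_nonneg (h01 x).1]; exact (h01 x).2⟩
    · exact ⟨_, hd j h hj⟩
  set lam : ℂ := -(c : ℂ) + Complex.I * (b : ℂ) with hlam
  have hdec : (fun ξ : ℝ => FT (fun x => ((q x : ℂ) + 2 * lam * (a x : ℂ)) *
        FTinv (fun y => (φ y : ℂ) * u y) x) ξ
      - (φ ξ : ℂ) * FT (fun x => ((q x : ℂ) + 2 * lam * (a x : ℂ)) * FTinv (⇑u) x) ξ) =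
      commF (fun x => (q x : ℂ)) φ u + (2 * lam) • commF (fun x => (a x : ℂ)) φ u := by
    ext ξ
    have e1 : ∀ g : ℝ → ℂ, (fun x => ((q x : ℂ) + 2 * lam * (a x : ℂ)) * g x) =
        fun x => (q x : ℂ) * g x + (2 * lam) * ((a x : ℂ) * g x) := fun g => by ext x; ring
    rw [e1, e1, FT_add_mul (hq.integrable_mul hφ h01 hφd u) (ha.integrable_mul hφ h01 hφd u),
      FT_add_mul (hq.integrable_mul_plain u) (ha.integrable_mul_plain u)]
    simp only [commF, Pi.add_apply, Pi.smul_apply, smul_eq_mul]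
    ring
  rw [hdec]
  obtain ⟨U, hU⟩ := exists_FTinv u
  have hUu : eLpNorm U 2 volume = eLpNorm u 2 volume := by rw [hU, eLpNorm_FTinv]
  set Y : ℝ≥0∞ := ENNReal.ofReal b⁻¹ * eLpNorm (Tq a q lam (FTinv (⇑u))) 2 volume
    + eLpNorm (⇑u) 2 volume with hY
  have huY : eLpNorm u 2 volume ≤ Y := le_add_self
  have haU : eLpNorm (fun x => (a x : ℂ) * U x) 2 volume ≤ ENNReal.ofReal E * Y := by
    refine (hen c b hc0 hb1 U).trans ?_
    rw [hUu, hU]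
    refine mul_le_mul' (ENNReal.ofReal_le_ofReal ?_) le_rfl
    rw [hE]
    gcongr
  set W := eLpNorm (fun x => ((1 + a x : ℝ) : ℂ) * FTinv u x) 2 volume with hW
  have hWY : W + eLpNorm u 2 volume ≤ ENNReal.ofReal (E + 2) * Y := by
    have e : (fun x => ((1 + a x : ℝ) : ℂ) * FTinv u x) = ⇑U + fun x => (a x : ℂ) * U x := by
      ext x; rw [← hU, Pi.add_apply]; push_cast; ring
    have hac := h.smooth_a.continuous
    have h1 : W ≤ eLpNorm u 2 volume + ENNReal.ofReal E * Y := by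
      rw [hW, e]
      refine (eLpNorm_add_le U.continuous.aestronglyMeasurable
        (Continuous.aestronglyMeasurable (by have := U.continuous; fun_prop)) (by norm_num)).trans ?_
      rw [hUu]
      gcongr
    calc W + eLpNorm u 2 volume ≤ (Y + ENNReal.ofReal E * Y) + Y := by
          refine add_le_add (h1.trans ?_) huY
          gcongr
      _ = (ENNReal.ofReal E + 2) * Y := by ring
      _ = _ := by
        rw [ENNReal.ofReal_add hE0 (by norm_num)]; simp
  have hcq' := hcq (δ * b) Λ hs hΛ φ hφ h01 hd u
  have hca' := hca (δ * b) Λ hs hΛ φ hφ h01 hd u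
  have hlamn : ‖2 * lam‖ ≤ 2 * (R + 1) * b := by
    have : ‖lam‖ ≤ c + b := by
      refine (norm_add_le _ _).trans ?_
      rw [norm_neg, norm_mul, Complex.norm_I, Complex.norm_real, Complex.norm_real,
        Real.norm_of_nonneg hc0, Real.norm_of_nonneg hb0.le, one_mul]
    rw [norm_mul, Complex.norm_ofNat]
    have : R ≤ R * b := le_mul_of_one_le_right hR0 hb1
    linarith
  have m1 : eLpNorm (commF (fun x => (q x : ℂ)) φ u) 2 volume ≤
      ENNReal.ofReal (Cq * Λ / δ) * (W + eLpNorm u 2 volume) := by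
    refine hcq'.trans (mul_le_mul' (ENNReal.ofReal_le_ofReal ?_) le_rfl)
    apply div_le_div_of_nonneg_left (by positivity) hδ0
    exact le_mul_of_one_le_right hδ0.le hb1
  have m2 : eLpNorm ((2 * lam) • commF (fun x => (a x : ℂ)) φ u) 2 volume ≤
      ENNReal.ofReal (2 * (R + 1) * (Ca * Λ / δ)) * (W + eLpNorm u 2 volume) := by
    rw [eLpNorm_const_smul]
    have e : ENNReal.ofReal (2 * (R + 1) * (Ca * Λ / δ)) =
        ENNReal.ofReal (2 * (R + 1) * b) * ENNReal.ofReal (Ca * Λ / (δ * b)) := by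
      rw [← ENNReal.ofReal_mul (by positivity)]
      congr 1
      field_simp
    rw [e, mul_assoc]
    refine mul_le_mul' ?_ hca'
    rw [← ofReal_norm_eq_enorm]
    exact ENNReal.ofReal_le_ofReal hlamn
  calc _ ≤ _ := eLpNorm_add_le (hq.commF_continuous hφ h01 hφd u).aestronglyMeasurable
        ((ha.commF_continuous hφ h01 hφd u).const_smul (2 * lam)).aestronglyMeasurable (by norm_num)
    _ ≤ _ := add_le_add m1 m2
    _ = ENNReal.ofReal D * (W + eLpNorm u 2 volume) := by
      rw [← add_mul, ← ENNReal.ofReal_add (by positivity) (by positivity)]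
    _ ≤ ENNReal.ofReal D * (ENNReal.ofReal (E + 2) * Y) := by gcongr
    _ = _ := by rw [← mul_assoc, ← ENNReal.ofReal_mul hD0.le]
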